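/- For every integer n ≥ 3, ospt(n) < p(n)/2. -/

import Mathlib

open scoped BigOperators

namespace RankCrank

/-- The `i`-th largest part of a partition (1-indexed); `0` if `i` exceeds
the number of parts. -/
def part {n : ℕ} (l : n.Partition) (i : ℕ) : ℕ :=
  ((l.parts.sort (· ≤ ·)).reverse).getD (i - 1) 0

/-- The rank of a partition: largest part minus number of parts. -/
def rank {n : ℕ} (l : n.Partition) : ℤ :=
  (part l 1 : ℤ) - l.parts.card

/-- The crank of a partition: the largest part if there are no parts equal to 1,
otherwise the number of parts larger than the number of 1's minus the number of 1's. -/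
def crank {n : ℕ} (l : n.Partition) : ℤ :=
  if l.parts.count 1 = 0 then (part l 1 : ℤ)
  else ((l.parts.filter (fun x => l.parts.count 1 < x)).card : ℤ) - l.parts.count 1

/-- `N m n` is the number of partitions of `n` with rank `m`. -/
noncomputable def N (m : ℤ) (n : ℕ) : ℕ :=
  Nat.card {l : n.Partition // rank l = m}

/-- `M m n` is the number of partitions of `n` with crank `m` for `n ≠ 1`, with the
usual convention for `n = 1`. -/
noncomputable def M (m : ℤ) (n : ℕ) : ℤ :=
  if n = 1 then (if m = 0 then -1 else if m = 1 ∨ m = -1 then 1 else 0)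
  else (Nat.card {l : n.Partition // crank l = m} : ℤ)

/-- `Nle m n = N(≤ m, n) = ∑_{r ≤ m} N(r,n)`; since `N(r,n) = 0` for `r < -n`,
the sum may be taken over `-n ≤ r ≤ m`. -/
noncomputable def Nle (m : ℤ) (n : ℕ) : ℤ :=
  ∑ r ∈ Finset.Icc (-(n : ℤ)) m, (N r n : ℤ)

/-- `Mle m n = M(≤ m, n) = ∑_{r ≤ m} M(r,n)`; since `M(r,n) = 0` for `r < -n`,
the sum may be taken over `-n ≤ r ≤ m`. -/
noncomputable def Mle (m : ℤ) (n : ℕ) : ℤ :=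
  ∑ r ∈ Finset.Icc (-(n : ℤ)) m, M r n

/-- The number of partitions of `n`. -/
noncomputable def p (n : ℕ) : ℕ := Nat.card n.Partition

/-- `ospt n = ∑_{m ≥ 0} m M(m,n) - ∑_{m ≥ 0} m N(m,n)`; since ranks and cranks of
partitions of `n` are at most `n`, the sums may be taken over `0 ≤ m ≤ n`. -/
noncomputable def ospt (n : ℕ) : ℤ :=
  (∑ m ∈ Finset.Icc (0 : ℤ) (n : ℤ), m * M m n) -
    (∑ m ∈ Finset.Icc (0 : ℤ) (n : ℤ), m * (N m n : ℤ))

/-- The rank-set of a partition `λ`:  `{j - λ_{j+1} : 0 ≤ j ≤ ℓ-1} ∪ {j : j ≥ ℓ}`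
(note `part l (j+1) = 0` for `j ≥ ℓ`). -/
def rankSet {n : ℕ} (l : n.Partition) : Set ℤ :=
  {x | ∃ j : ℕ, x = (j : ℤ) - (part l (j + 1) : ℤ)}

/-- `q m n` is the number of partitions of `n` whose rank-set contains `m`. -/
noncomputable def q (m : ℤ) (n : ℕ) : ℕ :=
  Nat.card {l : n.Partition // m ∈ rankSet l}

/-- `prank m n` is the number of partitions of `n` with rank at least `m`. -/
noncomputable def prank (m : ℤ) (n : ℕ) : ℕ :=
  Nat.card {l : n.Partition // m ≤ rank l}

/-- `jm m l` is the number of columns of the `m`-Durfee rectangle of `l`: the largest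
`j ≥ 0` with `λ_{m+j} ≥ j`. -/
noncomputable def jm {n : ℕ} (m : ℕ) (l : n.Partition) : ℕ :=
  sSup {j : ℕ | j ≤ part l (m + j)}

/-- The total number of smallest parts in all partitions of `n`. -/
def spt (n : ℕ) : ℕ :=
  ∑ l : n.Partition, l.parts.count ((l.parts.sort (· ≤ ·)).headD 0)

/-- A bijection `τ` on partitions of `n` nearly preserves the rank–crank
distribution if `crank λ - rank (τ λ)` is `0` when `crank λ = 0`, is `0` or `1`
when `crank λ > 0`, and is `0` or `-1` when `crank λ < 0`. -/
def NearlyPreserves {n : ℕ} (τ : n.Partition ≃ n.Partition) : Prop :=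
  ∀ l : n.Partition,
    (crank l = 0 → crank l - rank (τ l) = 0) ∧
    (0 < crank l → crank l - rank (τ l) = 0 ∨ crank l - rank (τ l) = 1) ∧
    (crank l < 0 → crank l - rank (τ l) = 0 ∨ crank l - rank (τ l) = -1)

/-- The number of elements of the multiset `s` that are at least `i`. -/
def numGE (s : Multiset ℕ) (i : ℕ) : ℕ := s.countP (i ≤ ·)

lemma numGE_zero (i : ℕ) : numGE 0 i = 0 := Multiset.countP_zero _

lemma numGE_cons (a : ℕ) (s : Multiset ℕ) (i : ℕ) :
    numGE (a ::ₘ s) i = numGE s i + if i ≤ a then 1 else 0 := Multiset.countP_cons _ _ _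

lemma numGE_add (s t : Multiset ℕ) (i : ℕ) : numGE (s + t) i = numGE s i + numGE t i :=
  Multiset.countP_add _ _ _

lemma numGE_eq_card {s : Multiset ℕ} {i : ℕ} (h : ∀ x ∈ s, i ≤ x) : numGE s i = s.card :=
  Multiset.countP_eq_card.2 h

lemma numGE_eq_zero {s : Multiset ℕ} {i : ℕ} (h : ∀ x ∈ s, x < i) : numGE s i = 0 :=
  Multiset.countP_eq_zero.2 fun x hx => not_le.2 (h x hx)

lemma numGE_pos {s : Multiset ℕ} {i : ℕ} : 0 < numGE s i ↔ ∃ x ∈ s, i ≤ x :=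
  Multiset.countP_pos

lemma numGE_antitone (s : Multiset ℕ) : Antitone (numGE s) := by
  intro i j hij
  simp only [numGE, Multiset.countP_eq_card_filter]
  exact Multiset.card_le_card (Multiset.monotone_filter_right s fun _ h => hij.trans h)

lemma numGE_succ_add_count (s : Multiset ℕ) (i : ℕ) :
    numGE s (i + 1) + s.count i = numGE s i := by
  induction s using Multiset.induction with
  | empty => simp [numGE]
  | cons a s ih =>
    rw [numGE_cons, numGE_cons, Multiset.count_cons]
    split_ifs <;> omega

lemma eq_of_numGE_eq {s t : Multiset ℕ} (h : ∀ i, numGE s i = numGE t i) : s = t := by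
  ext i
  have h1 := numGE_succ_add_count s i
  have h2 := numGE_succ_add_count t i
  rw [h, h] at h1
  omega

lemma numGE_one {n : ℕ} (l : n.Partition) : numGE l.parts 1 = l.parts.card :=
  numGE_eq_card fun _ hx => l.parts_pos hx

lemma numGE_eq_zero_of_lt {n : ℕ} (l : n.Partition) {i : ℕ} (h : n < i) :
    numGE l.parts i = 0 :=
  numGE_eq_zero fun _ hx => (l.le_of_mem_parts hx).trans_lt h

lemma sum_numGE (n : ℕ) (s : Multiset ℕ) (h : ∀ x ∈ s, x ≤ n) :
    ∑ i ∈ Finset.Icc 1 n, numGE s i = s.sum := by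
  induction s using Multiset.induction with
  | empty => simp [numGE]
  | cons a s ih =>
    have ha : a ≤ n := h a (Multiset.mem_cons_self a s)
    simp only [numGE_cons, Finset.sum_add_distrib, Multiset.sum_cons]
    rw [ih fun x hx => h x (Multiset.mem_cons_of_mem hx), add_comm]
    congr 1
    rw [Finset.sum_ite, Finset.sum_const_zero, add_zero, Finset.sum_const, smul_eq_mul, mul_one]
    have : (Finset.Icc 1 n).filter (· ≤ a) = Finset.Icc 1 a := by
      ext x; simp only [Finset.mem_filter, Finset.mem_Icc]; omega
    rw [this]; simp

/-- The conjugate partition. -/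
def conj {n : ℕ} (l : n.Partition) : n.Partition :=
  Nat.Partition.ofSums n ((Finset.Icc 1 n).val.map (numGE l.parts)) <| by
    have := sum_numGE n l.parts fun x hx => l.le_of_mem_parts hx
    rwa [l.parts_sum] at this

lemma le_numGE_conj {n : ℕ} (l : n.Partition) {i j : ℕ} (hi : 1 ≤ i) (hj : 1 ≤ j) :
    i ≤ numGE (conj l).parts j ↔ j ≤ numGE l.parts i := by
  have h1 : numGE (conj l).parts j = ((Finset.Icc 1 n).filter (j ≤ numGE l.parts ·)).card := by
    have h2 : numGE (conj l).parts j =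
        Multiset.countP (j ≤ ·)
          (((Finset.Icc 1 n).val.map (numGE l.parts)).filter (· ≠ 0)) := rfl
    rw [h2, Multiset.countP_filter, Multiset.countP_map, Finset.card_def, Finset.filter_val]
    congr 1
    refine Multiset.filter_congr fun x _ => ⟨fun h => h.1, fun h => ⟨h, by omega⟩⟩
  rw [h1]
  constructor
  · intro h
    by_contra hlt
    have : (Finset.Icc 1 n).filter (j ≤ numGE l.parts ·) ⊆ Finset.Icc 1 (i - 1) := by
      intro x hx
      simp only [Finset.mem_filter, Finset.mem_Icc] at hx ⊢
      refine ⟨hx.1.1, ?_⟩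
      by_contra hxi
      exact hlt (hx.2.trans (numGE_antitone _ (by omega)))
    have := Finset.card_le_card this
    simp only [Nat.card_Icc] at this
    omega
  · intro h
    have hin : i ≤ n := by
      by_contra hin
      rw [numGE_eq_zero_of_lt l (by omega)] at h
      omega
    have : Finset.Icc 1 i ⊆ (Finset.Icc 1 n).filter (j ≤ numGE l.parts ·) := by
      intro x hx
      simp only [Finset.mem_filter, Finset.mem_Icc] at hx ⊢
      exact ⟨⟨hx.1, by omega⟩, h.trans (numGE_antitone _ hx.2)⟩
    have := Finset.card_le_card this
    simp only [Nat.card_Icc] at this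
    omega

lemma conj_involutive (n : ℕ) : Function.Involutive (conj : n.Partition → n.Partition) := by
  intro l
  apply Nat.Partition.ext
  have key : ∀ i, 1 ≤ i → numGE (conj (conj l)).parts i = numGE l.parts i := by
    intro i hi
    apply le_antisymm
    · by_contra h
      push Not at h
      have h2 := (le_numGE_conj (conj l) (i := numGE l.parts i + 1) (by omega) hi).1 h
      have h3 := (le_numGE_conj l hi (by omega)).1 h2
      omega
    · rcases Nat.eq_zero_or_pos (numGE l.parts i) with h | h
      · omega
      · exact (le_numGE_conj (conj l) h hi).2 ((le_numGE_conj l hi h).2 le_rfl)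
  refine eq_of_numGE_eq fun i => ?_
  rcases Nat.eq_zero_or_pos i with rfl | hi
  · have h0 : ∀ μ : n.Partition, numGE μ.parts 0 = numGE μ.parts 1 := fun μ => by
      rw [← numGE_succ_add_count, Multiset.count_eq_zero_of_notMem, add_zero]
      exact fun h => absurd (μ.parts_pos h) (by omega)
    rw [h0, h0, key 1 le_rfl]
  · exact key i hi

lemma card_filter_conj {n : ℕ} (P Q : n.Partition → Prop) [DecidablePred P] [DecidablePred Q]
    (h : ∀ l, P l ↔ Q (conj l)) :
    (Finset.univ.filter P).card = (Finset.univ.filter Q).card := by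
  refine Finset.card_bij' (fun l _ => conj l) (fun l _ => conj l) ?_ ?_ ?_ ?_
  · simp only [Finset.mem_filter, Finset.mem_univ, true_and]; exact fun l hl => (h l).1 hl
  · simp only [Finset.mem_filter, Finset.mem_univ, true_and]
    intro l hl
    rw [h, conj_involutive n l]; exact hl
  · exact fun l _ => conj_involutive n l
  · exact fun l _ => conj_involutive n l

lemma le_part_one_iff {n : ℕ} (l : n.Partition) {i : ℕ} (hi : 1 ≤ i) :
    i ≤ part l 1 ↔ 1 ≤ numGE l.parts i := by
  have hs := Multiset.pairwise_sort l.parts (· ≤ ·)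
  rw [← List.pairwise_reverse] at hs
  have hm : ∀ x, x ∈ (l.parts.sort (· ≤ ·)).reverse ↔ x ∈ l.parts := by simp
  rw [Nat.succ_le_iff, numGE_pos]
  unfold part
  generalize (l.parts.sort (· ≤ ·)).reverse = L at hs hm
  simp only [← hm]
  cases L with
  | nil => simp; omega
  | cons a L =>
    simp only [List.pairwise_cons] at hs
    simp only [Nat.sub_self, List.getD_cons_zero]
    constructor
    · exact fun h => ⟨a, by simp, h⟩
    · rintro ⟨x, hx, hix⟩
      rcases List.mem_cons.1 hx with rfl | hx
      · exact hix
      · exact hix.trans (hs.1 x hx)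

lemma part_one_conj {n : ℕ} (l : n.Partition) : part (conj l) 1 = l.parts.card := by
  refine eq_of_forall_le_iff fun i => ?_
  rcases Nat.eq_zero_or_pos i with rfl | hi
  · simp
  · rw [le_part_one_iff _ hi, le_numGE_conj _ le_rfl hi, numGE_one]

lemma rank_conj {n : ℕ} (l : n.Partition) : rank (conj l) = - rank l := by
  have h1 := part_one_conj l
  have h2 := part_one_conj (conj l)
  rw [conj_involutive n l] at h2
  unfold rank
  omega

/-- Exactly `m + j` elements of `s` are at least `j`, for some positive `j`. For the parts of a
partition this says that `m` does not belong to the rank-set. -/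
def Balanced (m : ℕ) (s : Multiset ℕ) : Prop := ∃ j, 1 ≤ j ∧ numGE s j = m + j

/-- For some positive `j`, the `j`-th largest element of `s` is `j`. -/
def HasFixedPart (s : Multiset ℕ) : Prop := ∃ j, 1 ≤ j ∧ numGE s (j + 1) < j ∧ j ≤ numGE s j

lemma not_balanced_of {m J : ℕ} {s : Multiset ℕ} (h1 : numGE s (J + 1) < m + J + 1)
    (h2 : m + J < numGE s J) : ¬ Balanced m s := by
  rintro ⟨i, -, hi⟩
  rcases Nat.lt_or_ge J i with h | h
  · have := numGE_antitone s (show J + 1 ≤ i from h)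
    omega
  · have := numGE_antitone s h
    omega

lemma not_hasFixedPart_of {J : ℕ} {s : Multiset ℕ} (h1 : numGE s (J + 1) = J)
    (h2 : J < numGE s J) : ¬ HasFixedPart s := by
  rintro ⟨i, -, hi, hi'⟩
  rcases Nat.lt_trichotomy J i with h | h | h
  · have := numGE_antitone s (show J + 1 ≤ i from h)
    omega
  · subst h; omega
  · have := numGE_antitone s (show i + 1 ≤ J from h)
    omega

lemma level_unique {m J K : ℕ} {s : Multiset ℕ} (h1 : numGE s (J + 1) < m + J + 1)
    (h2 : m + J < numGE s J) (h3 : numGE s (K + 1) < m + K + 1) (h4 : m + K < numGE s K) :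
    J = K := by
  rcases Nat.lt_trichotomy J K with h | h | h
  · have := numGE_antitone s (show J + 1 ≤ K from h)
    omega
  · exact h
  · have := numGE_antitone s (show K + 1 ≤ J from h)
    omega

lemma balanced_iff_conj {n : ℕ} (l : n.Partition) :
    Balanced 0 l.parts ↔ HasFixedPart (conj l).parts := by
  refine exists_congr fun j => and_congr_right fun hj => ?_
  have h1 := le_numGE_conj l hj hj
  have h2 := le_numGE_conj l hj (show 1 ≤ j + 1 by omega)
  omega

/-- `μ` arises from `l` by enlarging a largest part by one and replacing a part `j`, where `j` is
the side of the Durfee square of `l`, by `j - 1`. -/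
def DurfeeShrink {n : ℕ} (l μ : n.Partition) : Prop :=
  ∃ j t xs, 2 ≤ j ∧ j ≤ t ∧ (∀ x ∈ xs, x ≤ t) ∧ numGE xs j + 2 = j ∧
    l.parts = j ::ₘ t ::ₘ xs ∧ μ.parts = (j - 1) ::ₘ (t + 1) ::ₘ xs

lemma DurfeeShrink.numGE_eq {xs : Multiset ℕ} {j t : ℕ} (hj : 2 ≤ j) (hjt : j ≤ t)
    (hxs : numGE xs j + 2 = j) : numGE ((j - 1) ::ₘ (t + 1) ::ₘ xs) (j - 1 + 1) = j - 1 ∧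
      j - 1 < numGE ((j - 1) ::ₘ (t + 1) ::ₘ xs) (j - 1) := by
  have h1 := numGE_antitone xs (show j - 1 ≤ j by omega)
  simp only [numGE_cons, show j - 1 + 1 = j by omega]
  split_ifs <;> omega

lemma DurfeeShrink.left_unique {n : ℕ} {l l' μ : n.Partition} (h : DurfeeShrink l μ)
    (h' : DurfeeShrink l' μ) : l = l' := by
  obtain ⟨j, t, xs, hj, hjt, hmax, hxs, hl, hμ⟩ := h
  obtain ⟨j', t', xs', hj', hjt', hmax', hxs', hl', hμ'⟩ := h'
  have e := DurfeeShrink.numGE_eq hj hjt hxs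
  have e' := DurfeeShrink.numGE_eq hj' hjt' hxs'
  rw [← hμ] at e
  rw [← hμ'] at e'
  have hjj : j - 1 = j' - 1 := level_unique (m := 0) (s := μ.parts) (by omega) (by omega)
    (by omega) (by omega)
  obtain rfl : j = j' := by omega
  have hp : (t + 1) ::ₘ xs = (t' + 1) ::ₘ xs' := by
    rw [hμ] at hμ'
    exact (Multiset.cons_inj_right _).1 hμ'
  have h1 : t + 1 ∈ (t' + 1) ::ₘ xs' := hp ▸ Multiset.mem_cons_self _ _
  have h2 : t' + 1 ∈ (t + 1) ::ₘ xs := hp ▸ Multiset.mem_cons_self _ _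
  have htt : t = t' := by
    rcases Multiset.mem_cons.1 h1 with h1 | h1 <;> rcases Multiset.mem_cons.1 h2 with h2 | h2
    · omega
    · omega
    · omega
    · have := hmax _ h2
      have := hmax' _ h1
      omega
  subst htt
  have hxx : xs = xs' := (Multiset.cons_inj_right _).1 hp
  subst hxx
  exact Nat.Partition.ext (hl.trans hl'.symm)

lemma exists_max_cons {s : Multiset ℕ} (hs : s ≠ 0) : ∃ t xs, s = t ::ₘ xs ∧ ∀ x ∈ s, x ≤ t := by
  obtain ⟨t, ht, hmax⟩ := Multiset.exists_max_image id hs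
  obtain ⟨xs, rfl⟩ := Multiset.exists_cons_of_mem ht
  exact ⟨t, xs, rfl, hmax⟩

lemma exists_durfeeShrink {n : ℕ} (hn : 2 ≤ n) (l : n.Partition) (hb : Balanced 0 l.parts)
    (hf : HasFixedPart l.parts) : ∃ μ, DurfeeShrink l μ := by
  obtain ⟨j, hj1, hj⟩ := hb
  obtain ⟨i, hi1, hi, hi'⟩ := hf
  obtain rfl : i = j := by
    rcases Nat.lt_trichotomy i j with h | h | h
    · have := numGE_antitone l.parts (show i + 1 ≤ j from h)
      omega
    · exact h
    · have := numGE_antitone l.parts h.le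
      omega
  have hcount := numGE_succ_add_count l.parts i
  obtain ⟨s, hs⟩ := Multiset.exists_cons_of_mem
    (Multiset.count_pos.1 (show 0 < l.parts.count i by omega))
  have hsum := l.parts_sum
  have hgs : numGE s i + 1 = i := by
    rw [hs, numGE_cons, if_pos le_rfl] at hj
    omega
  have hs0 : s ≠ 0 := by
    rintro rfl
    rw [hs, Multiset.sum_cons, Multiset.sum_zero] at hsum
    rw [numGE_zero] at hgs
    omega
  have hi2 : 2 ≤ i := by
    by_contra hlt
    obtain ⟨x, hx⟩ := Multiset.exists_mem_of_ne_zero hs0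
    have : 0 < numGE s i := numGE_pos.2
      ⟨x, hx, by have := l.parts_pos (hs ▸ Multiset.mem_cons_of_mem hx); omega⟩
    omega
  obtain ⟨t, xs, rfl, hmax⟩ := exists_max_cons hs0
  have hit : i ≤ t := by
    obtain ⟨x, hx, hix⟩ := numGE_pos.1 (show 0 < numGE (t ::ₘ xs) i by omega)
    exact hix.trans (hmax x hx)
  rw [numGE_cons, if_pos hit] at hgs
  refine ⟨⟨(i - 1) ::ₘ (t + 1) ::ₘ xs, ?_, ?_⟩, i, t, xs, hi2, hit,
    fun x hx => hmax x (Multiset.mem_cons_of_mem hx), by omega, hs, rfl⟩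
  · intro x hx
    rcases Multiset.mem_cons.1 hx with rfl | hx
    · omega
    rcases Multiset.mem_cons.1 hx with rfl | hx
    · omega
    exact l.parts_pos (hs ▸ by simp [hx])
  · simp only [hs, Multiset.sum_cons] at hsum ⊢
    omega

open Classical in
lemma two_mul_card_balanced_lt {n : ℕ} (hn : 3 ≤ n) :
    2 * (Finset.univ.filter fun l : n.Partition => Balanced 0 l.parts).card
      < Fintype.card n.Partition := by
  let B : n.Partition → Prop := fun l => Balanced 0 l.parts
  let F : n.Partition → Prop := fun l => HasFixedPart l.parts
  have hBF : (Finset.univ.filter B).card = (Finset.univ.filter F).card :=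
    card_filter_conj _ _ balanced_iff_conj
  let μ₀ : n.Partition := ⟨2 ::ₘ Multiset.replicate (n - 2) 1, by
      intro i hi
      rcases Multiset.mem_cons.1 hi with rfl | hi
      · omega
      · rw [Multiset.eq_of_mem_replicate hi]; omega, by simp; omega⟩
  have h2 : numGE μ₀.parts (1 + 1) = 1 := by
    simp only [μ₀, numGE_cons]
    rw [numGE_eq_zero fun x hx => by rw [Multiset.eq_of_mem_replicate hx]; omega]
    simp
  have h1 : 1 < numGE μ₀.parts 1 := by
    rw [numGE_one]
    simp only [μ₀, Multiset.card_cons, Multiset.card_replicate]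
    omega
  have hlt : (Finset.univ.filter fun l => B l ∧ F l).card <
      (Finset.univ.filter fun l => ¬ B l ∧ ¬ F l).card := by
    have hμ₀ : μ₀ ∈ Finset.univ.filter fun l => ¬ B l ∧ ¬ F l := by
      simp only [Finset.mem_filter, Finset.mem_univ, true_and]
      exact ⟨not_balanced_of (J := 1) (by omega) (by omega), not_hasFixedPart_of h2 h1⟩
    refine lt_of_le_of_lt ?_ (Finset.card_erase_lt_of_mem hμ₀)
    refine Finset.card_le_card_of_forall_subsingleton DurfeeShrink ?_
      fun μ _ l hl l' hl' => hl.2.left_unique hl'.2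
    intro l hl
    simp only [Finset.mem_filter, Finset.mem_univ, true_and] at hl
    obtain ⟨μ, hμ⟩ := exists_durfeeShrink (by omega) l hl.1 hl.2
    refine ⟨μ, ?_, hμ⟩
    obtain ⟨j, t, xs, hj, hjt, hmax, hxs, -, hμp⟩ := hμ
    obtain ⟨e1, e2⟩ := DurfeeShrink.numGE_eq hj hjt hxs
    rw [← hμp] at e1 e2
    simp only [Finset.mem_erase, Finset.mem_filter, Finset.mem_univ, true_and]
    refine ⟨?_, not_balanced_of (J := j - 1) (by omega) (by omega), not_hasFixedPart_of e1 e2⟩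
    rintro rfl
    have : t + 1 ∈ 2 ::ₘ Multiset.replicate (n - 2) 1 := by
      change t + 1 ∈ μ₀.parts
      rw [hμp]; simp
    rcases Multiset.mem_cons.1 this with h | h
    · omega
    · have := Multiset.eq_of_mem_replicate h
      omega
  have e1 := Finset.card_filter_add_card_filter_not (s := (Finset.univ : Finset n.Partition)) B
  have e2 := Finset.card_filter_add_card_filter_not (s := Finset.univ.filter B) F
  have e3 := Finset.card_filter_add_card_filter_not (s := Finset.univ.filter F) B
  have e4 := Finset.card_filter_add_card_filter_not
    (s := Finset.univ.filter fun l => ¬ B l) F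
  simp only [Finset.filter_filter] at e2 e3 e4
  have e5 : (Finset.univ.filter fun l => F l ∧ B l).card =
    (Finset.univ.filter fun l => B l ∧ F l).card := by simp only [and_comm]
  have e6 : (Finset.univ.filter fun l => F l ∧ ¬ B l).card =
    (Finset.univ.filter fun l => ¬ B l ∧ F l).card := by simp only [and_comm]
  rw [Finset.card_univ] at e1
  change 2 * (Finset.univ.filter B).card < _
  omega

/-- Add one to every element of `s` and adjoin ones so that the result has `k` elements: this adds
a column of height `k` to a Young diagram. -/
def addColumn (k : ℕ) (s : Multiset ℕ) : Multiset ℕ :=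
  s.map (· + 1) + Multiset.replicate (k - s.card) 1

lemma card_addColumn {k : ℕ} {s : Multiset ℕ} (h : s.card ≤ k) : (addColumn k s).card = k := by
  simp [addColumn, h]

lemma sum_addColumn {k : ℕ} {s : Multiset ℕ} (h : s.card ≤ k) :
    (addColumn k s).sum = s.sum + k := by
  simp only [addColumn, Multiset.sum_add, Multiset.sum_map_add, Multiset.map_id',
    Multiset.map_const', Multiset.sum_replicate, smul_eq_mul, mul_one]
  omega

lemma le_of_mem_addColumn {k v : ℕ} {s : Multiset ℕ} (hv : 1 ≤ v) (h : ∀ x ∈ s, x < v) :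
    ∀ x ∈ addColumn k s, x ≤ v := by
  intro x hx
  rcases Multiset.mem_add.1 hx with hx | hx
  · obtain ⟨y, hy, rfl⟩ := Multiset.mem_map.1 hx
    exact h y hy
  · rwa [Multiset.eq_of_mem_replicate hx]

lemma pos_of_mem_addColumn {k : ℕ} {s : Multiset ℕ} : ∀ x ∈ addColumn k s, 0 < x := by
  intro x hx
  rcases Multiset.mem_add.1 hx with hx | hx
  · obtain ⟨y, hy, rfl⟩ := Multiset.mem_map.1 hx
    omega
  · rw [Multiset.eq_of_mem_replicate hx]; omega

lemma filter_map_pred_addColumn {k : ℕ} {s : Multiset ℕ} (h : ∀ x ∈ s, 0 < x) :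
    ((addColumn k s).map (· - 1)).filter (0 < ·) = s := by
  simp only [addColumn, Multiset.map_add, Multiset.map_map, Multiset.map_replicate,
    Multiset.filter_add, Function.comp_def, Nat.add_sub_cancel, Multiset.map_id']
  rw [Multiset.filter_eq_self.2 h, Multiset.filter_eq_nil.2, add_zero]
  intro x hx
  rw [Multiset.eq_of_mem_replicate hx]
  omega

lemma split_unique {j : ℕ} {xs ys xs' ys' : Multiset ℕ} (hx : ∀ x ∈ xs, j ≤ x)
    (hx' : ∀ x ∈ xs', j ≤ x) (hy : ∀ y ∈ ys, y ≤ j) (hy' : ∀ y ∈ ys', y ≤ j)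
    (hc : xs.card = xs'.card) (h : xs + ys = xs' + ys') : xs = xs' ∧ ys = ys' := by
  have hxs : xs = xs' := by
    refine eq_of_numGE_eq fun i => ?_
    rcases Nat.lt_or_ge j i with hi | hi
    · have h1 := numGE_add xs ys i
      have h2 := numGE_add xs' ys' i
      rw [numGE_eq_zero (s := ys) fun y hm => (hy y hm).trans_lt hi] at h1
      rw [numGE_eq_zero (s := ys') fun y hm => (hy' y hm).trans_lt hi, ← h] at h2
      omega
    · rw [numGE_eq_card fun x hm => hi.trans (hx x hm),
        numGE_eq_card fun x hm => hi.trans (hx' x hm), hc]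
  subst hxs
  exact ⟨rfl, add_left_cancel h⟩

/-- `μ` arises from `l` by deleting the largest part `t`, inserting a new part `v` just below the
`m + j - 1` remaining parts that are at least `j`, and adding a column of height `t - v` below. -/
def RowToColumn (m : ℕ) {n : ℕ} (l μ : n.Partition) : Prop :=
  ∃ j v t xs ys, 1 ≤ v ∧ (∀ x ∈ xs, j ≤ x ∧ x ≤ t) ∧ (∀ y ∈ ys, 0 < y ∧ y < v) ∧
    xs.card + 1 = m + j ∧ ys.card + v < t ∧ (v = j ∧ (j = 1 ∨ j - 1 ∈ ys) ∨ v + 1 = j) ∧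
    l.parts = t ::ₘ (xs + ys) ∧ μ.parts = v ::ₘ (xs + addColumn (t - v) ys)

lemma RowToColumn.numGE_eq {m j v t : ℕ} {xs ys : Multiset ℕ} (hv : 1 ≤ v)
    (hx : ∀ x ∈ xs, j ≤ x ∧ x ≤ t) (hy : ∀ y ∈ ys, 0 < y ∧ y < v) (hc : xs.card + 1 = m + j)
    (hvt : ys.card + v < t) (hvj : v = j ∧ (j = 1 ∨ j - 1 ∈ ys) ∨ v + 1 = j) :
    m + v < numGE (v ::ₘ (xs + addColumn (t - v) ys)) v ∧
      (v = j ∧ numGE (v ::ₘ (xs + addColumn (t - v) ys)) (v + 1) < m + v ∨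
        v + 1 = j ∧ numGE (v ::ₘ (xs + addColumn (t - v) ys)) (v + 1) = m + v) := by
  have hcol : numGE (addColumn (t - v) ys) (v + 1) = 0 := numGE_eq_zero fun x hx =>
    Nat.lt_succ_of_le (le_of_mem_addColumn hv (fun y hm => (hy y hm).2) x hx)
  have hxv : numGE xs v = xs.card := numGE_eq_card fun x hm => by
    have := (hx x hm).1
    omega
  simp only [numGE_cons, numGE_add, hcol, hxv, le_refl, if_true,
    if_neg (show ¬ v + 1 ≤ v by omega)]
  rcases hvj with ⟨rfl, h⟩ | rfl
  · have h1 : 0 < numGE (addColumn (t - v) ys) v := by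
      rw [numGE_pos]
      rcases h with rfl | h
      · refine ⟨1, Multiset.mem_add.2 (Or.inr ?_), le_rfl⟩
        rw [Multiset.mem_replicate]
        exact ⟨by omega, rfl⟩
      · exact ⟨v - 1 + 1, Multiset.mem_add.2 (Or.inl (Multiset.mem_map_of_mem _ h)), by omega⟩
    have h2 : numGE xs (v + 1) ≤ xs.card := Multiset.countP_le_card _ _
    omega
  · have h2 : numGE xs (v + 1) = xs.card := numGE_eq_card fun x hm => (hx x hm).1
    omega

lemma RowToColumn.left_unique {m n : ℕ} {l l' μ : n.Partition} (h : RowToColumn m l μ)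
    (h' : RowToColumn m l' μ) : l = l' := by
  obtain ⟨j, v, t, xs, ys, hv, hx, hy, hc, hvt, hvj, hl, hμ⟩ := h
  obtain ⟨j', v', t', xs', ys', hv', hx', hy', hc', hvt', hvj', hl', hμ'⟩ := h'
  have e := RowToColumn.numGE_eq hv hx hy hc hvt hvj
  have e' := RowToColumn.numGE_eq hv' hx' hy' hc' hvt' hvj'
  rw [← hμ] at e
  rw [← hμ'] at e'
  obtain rfl : v = v' := level_unique (m := m) (s := μ.parts) (by omega) (by omega)
    (by omega) (by omega)
  obtain rfl : j = j' := by omega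
  have hcons : v ::ₘ (xs + addColumn (t - v) ys) = v ::ₘ (xs' + addColumn (t' - v) ys') :=
    hμ.symm.trans hμ'
  have hcol : ∀ k (s : Multiset ℕ), (∀ y ∈ s, 0 < y ∧ y < v) → ∀ x ∈ addColumn k s, x ≤ j :=
    fun k s hs x hm =>
      (le_of_mem_addColumn hv (fun y hy => (hs y hy).2) x hm).trans (by omega)
  obtain ⟨rfl, hW⟩ := split_unique (fun x hm => (hx x hm).1) (fun x hm => (hx' x hm).1)
    (hcol _ _ hy) (hcol _ _ hy') (by omega) ((Multiset.cons_inj_right _).1 hcons)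
  have hcard := congrArg Multiset.card hW
  rw [card_addColumn (by omega), card_addColumn (by omega)] at hcard
  obtain rfl : t = t' := by omega
  have hys : ys = ys' := by
    rw [← filter_map_pred_addColumn (k := t - v) fun y hm => (hy y hm).1, hW,
      filter_map_pred_addColumn fun y hm => (hy' y hm).1]
  subst hys
  exact Nat.Partition.ext (hl.trans hl'.symm)

lemma exists_rowToColumn {m n : ℕ} (l : n.Partition) (hb : Balanced m l.parts)
    (hr : l.parts.card < m + part l 1) : ∃ μ, RowToColumn m l μ := by
  obtain ⟨j, hj1, hj⟩ := hb
  have hne : l.parts ≠ 0 := by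
    intro h
    rw [h, numGE_zero] at hj
    omega
  obtain ⟨t, s, hs, hmax⟩ := exists_max_cons hne
  have hgepos : 0 < numGE l.parts j := by omega
  have htj : j ≤ t := by
    obtain ⟨x, hx, hjx⟩ := numGE_pos.1 hgepos
    exact hjx.trans (hmax x hx)
  have ht : part l 1 ≤ t := by
    rcases Nat.eq_zero_or_pos (part l 1) with h | h
    · omega
    · obtain ⟨x, hx, hx'⟩ := numGE_pos.1 ((le_part_one_iff l h).1 le_rfl)
      exact hx'.trans (hmax x hx)
  obtain ⟨xs, hxs⟩ : ∃ xs, xs = s.filter (j ≤ ·) := ⟨_, rfl⟩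
  obtain ⟨ys, hys⟩ : ∃ ys, ys = s.filter (¬ j ≤ ·) := ⟨_, rfl⟩
  have hsplit : xs + ys = s := by rw [hxs, hys, Multiset.filter_add_not]
  have hxc : xs.card + 1 = m + j := by
    rw [hs, numGE_cons, if_pos htj, numGE, Multiset.countP_eq_card_filter, ← hxs] at hj
    exact hj
  have hyc : ys.card + j < t := by
    rw [hs, Multiset.card_cons, ← hsplit, Multiset.card_add] at hr
    omega
  have hmem : ∀ x ∈ s, 0 < x := fun x hx =>
    l.parts_pos (hs ▸ Multiset.mem_cons_of_mem hx)
  have hx : ∀ x ∈ xs, j ≤ x ∧ x ≤ t := fun x hm => by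
    rw [hxs, Multiset.mem_filter] at hm
    exact ⟨hm.2, hmax x (hs ▸ Multiset.mem_cons_of_mem hm.1)⟩
  have hy : ∀ y ∈ ys, 0 < y ∧ y < j := fun y hm => by
    rw [hys, Multiset.mem_filter] at hm
    exact ⟨hmem y hm.1, not_le.1 hm.2⟩
  have hsum := l.parts_sum
  rw [hs, Multiset.sum_cons, ← hsplit, Multiset.sum_add] at hsum
  obtain ⟨v, hv, hvy, hvj⟩ : ∃ v, 1 ≤ v ∧ (∀ y ∈ ys, 0 < y ∧ y < v) ∧
      (v = j ∧ (j = 1 ∨ j - 1 ∈ ys) ∨ v + 1 = j) := by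
    by_cases h : j = 1 ∨ j - 1 ∈ ys
    · exact ⟨j, hj1, hy, Or.inl ⟨rfl, h⟩⟩
    · push Not at h
      refine ⟨j - 1, by omega, fun y hm => ⟨(hy y hm).1, ?_⟩, Or.inr (by omega)⟩
      have h1 : y ≠ j - 1 := fun h' => h.2 (h' ▸ hm)
      have h2 := (hy y hm).2
      omega
  refine ⟨⟨v ::ₘ (xs + addColumn (t - v) ys), ?_, ?_⟩, j, v, t, xs, ys, hv, hx, hvy, hxc,
    by omega, hvj, by rw [hsplit, hs], rfl⟩
  · intro i hi
    rcases Multiset.mem_cons.1 hi with rfl | hi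
    · omega
    rcases Multiset.mem_add.1 hi with hi | hi
    · have := hx i hi
      omega
    · exact pos_of_mem_addColumn i hi
  · rw [Multiset.sum_cons, Multiset.sum_add, sum_addColumn (by omega)]
    omega

open Classical in
lemma card_balanced_le (m n : ℕ) :
    (Finset.univ.filter fun l : n.Partition => Balanced m l.parts).card ≤
      (Finset.univ.filter fun l : n.Partition => (m : ℤ) ≤ rank l).card := by
  let B : n.Partition → Prop := fun l => Balanced m l.parts
  let R : n.Partition → Prop := fun l => m + part l 1 ≤ l.parts.card
  have hR : (Finset.univ.filter fun l : n.Partition => (m : ℤ) ≤ rank l).card =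
      (Finset.univ.filter R).card := by
    refine card_filter_conj _ _ fun l => ?_
    have := rank_conj l
    unfold rank at this ⊢
    simp only [R]
    omega
  rw [hR]
  have hle : (Finset.univ.filter fun l => B l ∧ ¬ R l).card ≤
      (Finset.univ.filter fun l => R l ∧ ¬ B l).card := by
    refine Finset.card_le_card_of_forall_subsingleton (RowToColumn m) ?_
      fun μ _ l hl l' hl' => hl.2.left_unique hl'.2
    intro l hl
    simp only [Finset.mem_filter, Finset.mem_univ, true_and] at hl
    obtain ⟨μ, hμ⟩ := exists_rowToColumn l hl.1 (not_le.1 hl.2)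
    refine ⟨μ, ?_, hμ⟩
    obtain ⟨j, v, t, xs, ys, hv, hx, hy, hc, hvt, hvj, -, hμp⟩ := hμ
    have e := RowToColumn.numGE_eq hv hx hy hc hvt hvj
    rw [← hμp] at e
    simp only [Finset.mem_filter, Finset.mem_univ, true_and]
    refine ⟨?_, not_balanced_of (J := v) (by omega) (by omega)⟩
    have hp : part μ 1 ≤ t := by
      by_contra hlt
      obtain ⟨x, hxm, hxt⟩ := numGE_pos.1 ((le_part_one_iff μ (i := t + 1) (by omega)).1
        (by omega))
      rw [hμp] at hxm
      rcases Multiset.mem_cons.1 hxm with rfl | hxm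
      · omega
      rcases Multiset.mem_add.1 hxm with hxm | hxm
      · have := hx x hxm
        omega
      · have := le_of_mem_addColumn hv (fun y hm => (hy y hm).2) x hxm
        omega
    simp only [R]
    rw [hμp, Multiset.card_cons, Multiset.card_add, card_addColumn (by omega)]
    omega
  have e2 := Finset.card_filter_add_card_filter_not (s := Finset.univ.filter B) R
  have e3 := Finset.card_filter_add_card_filter_not (s := Finset.univ.filter R) B
  simp only [Finset.filter_filter] at e2 e3
  have e5 : (Finset.univ.filter fun l => R l ∧ B l).card =
    (Finset.univ.filter fun l => B l ∧ R l).card := by simp only [and_comm]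
  change (Finset.univ.filter B).card ≤ _
  omega

open Classical in
lemma card_filter_add_parts (N k : ℕ) (s : Multiset ℕ) (hs : ∀ x ∈ s, 0 < x) (hk : s.sum = k)
    (P : Multiset ℕ → Prop) :
    (Finset.univ.filter fun l : N.Partition => ∃ γ, l.parts = γ + s ∧ P γ).card =
      if k ≤ N then
        (Finset.univ.filter fun l : (N - k).Partition => P l.parts).card else 0 := by
  subst hk
  split_ifs with hN
  · symm
    refine Finset.card_bij (fun μ _ => ⟨μ.parts + s, fun {i} hi => ?_, ?_⟩) ?_ ?_ ?_
    · rcases Multiset.mem_add.1 hi with hi | hi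
      · exact μ.parts_pos hi
      · exact hs i hi
    · rw [Multiset.sum_add, μ.parts_sum]
      omega
    · intro μ hμ
      simp only [Finset.mem_filter, Finset.mem_univ, true_and] at hμ ⊢
      exact ⟨μ.parts, rfl, hμ⟩
    · intro μ _ ν _ h
      exact Nat.Partition.ext (add_right_cancel (congrArg Nat.Partition.parts h))
    · intro l hl
      simp only [Finset.mem_filter, Finset.mem_univ, true_and] at hl
      obtain ⟨γ, hγ, hP⟩ := hl
      have hsum := l.parts_sum
      rw [hγ, Multiset.sum_add] at hsum
      refine ⟨⟨γ, fun {i} hi => l.parts_pos (hγ ▸ Multiset.mem_add.2 (Or.inl hi)), by omega⟩,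
        by simpa using hP, Nat.Partition.ext hγ.symm⟩
  · rw [Finset.card_eq_zero, Finset.filter_eq_empty_iff]
    rintro l - ⟨γ, hγ, -⟩
    have hsum := l.parts_sum
    rw [hγ, Multiset.sum_add] at hsum
    omega

open Classical in
lemma card_filter_ones_eq (n k : ℕ) (hk : 1 ≤ k) (P : Multiset ℕ → Prop) :
    (Finset.univ.filter fun l : n.Partition =>
        ∃ γ, l.parts = γ + Multiset.replicate k 1 ∧ P γ).card =
      (Finset.univ.filter fun l : n.Partition => ∃ γ, l.parts = γ + {k} ∧ P γ).card := by
  rw [card_filter_add_parts n k (Multiset.replicate k 1)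
    (fun x hx => by rw [Multiset.eq_of_mem_replicate hx]; omega) (by simp) P,
    card_filter_add_parts n k {k} (fun x hx => by rw [Multiset.mem_singleton.1 hx]; omega)
      (by simp) P]

lemma numGE_singleton (a i : ℕ) : numGE {a} i = if i ≤ a then 1 else 0 := by
  rw [← Multiset.cons_zero, numGE_cons, numGE_zero, zero_add]

lemma le_count_and_iff {s : Multiset ℕ} {k i c : ℕ} (hi : 2 ≤ i) :
    (k ≤ s.count 1 ∧ c ≤ numGE s i) ↔
      ∃ γ, s = γ + Multiset.replicate k 1 ∧ c ≤ numGE γ i := by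
  have hrep : numGE (Multiset.replicate k 1) i = 0 := numGE_eq_zero fun x hx => by
    rw [Multiset.eq_of_mem_replicate hx]; omega
  rw [Multiset.le_count_iff_replicate_le]
  constructor
  · rintro ⟨h, hc⟩
    obtain ⟨γ, rfl⟩ := Multiset.le_iff_exists_add.1 h
    rw [numGE_add, hrep, zero_add] at hc
    exact ⟨γ, add_comm _ _, hc⟩
  · rintro ⟨γ, rfl, hc⟩
    rw [numGE_add, hrep, add_zero]
    exact ⟨Multiset.le_add_left _ _, hc⟩

lemma mem_and_iff {s : Multiset ℕ} {k i c : ℕ} :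
    (k ∈ s ∧ c + (if i ≤ k then 1 else 0) ≤ numGE s i) ↔
      ∃ γ, s = γ + {k} ∧ c ≤ numGE γ i := by
  constructor
  · rintro ⟨h, hc⟩
    obtain ⟨γ, rfl⟩ := Multiset.exists_cons_of_mem h
    rw [numGE_cons] at hc
    refine ⟨γ, by rw [add_comm, Multiset.singleton_add], by omega⟩
  · rintro ⟨γ, rfl, hc⟩
    rw [numGE_add, numGE_singleton]
    refine ⟨by simp, by omega⟩

open Classical in
lemma card_filter_le_count_one (n k i c : ℕ) (hk : 1 ≤ k) (hi : 2 ≤ i) :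
    (Finset.univ.filter fun l : n.Partition =>
        k ≤ l.parts.count 1 ∧ c ≤ numGE l.parts i).card =
      (Finset.univ.filter fun l : n.Partition =>
        k ∈ l.parts ∧ c + (if i ≤ k then 1 else 0) ≤ numGE l.parts i).card := by
  simp only [mem_and_iff, le_count_and_iff hi]
  exact card_filter_ones_eq n k hk _

lemma one_le_numGE_iff_conj {n : ℕ} (l : n.Partition) (m : ℕ) :
    1 ≤ numGE l.parts (m + 1) ↔ m + 1 ≤ numGE (conj l).parts 1 :=
  (le_numGE_conj l (by omega) le_rfl).symm

open Classical in
lemma card_filter_one_mem (n m : ℕ) (hn : 2 ≤ n) :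
    (Finset.univ.filter fun l : n.Partition =>
        1 ≤ l.parts.count 1 ∧ 1 ≤ numGE l.parts (m + 1)).card =
      (Finset.univ.filter fun l : n.Partition =>
        1 ∈ l.parts ∧ m + 2 ≤ numGE l.parts 1).card := by
  have h1 : ∀ l : n.Partition, (1 ≤ l.parts.count 1 ∧ 1 ≤ numGE l.parts (m + 1)) ↔
      ∃ γ, l.parts = γ + {1} ∧ 1 ≤ numGE γ (m + 1) := by
    intro l
    rw [Nat.succ_le_iff, Multiset.count_pos, ← mem_and_iff]
    refine and_congr_right fun hmem => ?_
    split_ifs with hm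
    · obtain rfl : m = 0 := by omega
      obtain ⟨γ, hγ⟩ := Multiset.exists_cons_of_mem hmem
      have hsum := l.parts_sum
      rw [hγ, Multiset.sum_cons] at hsum
      have hne : γ ≠ 0 := by
        rintro rfl
        rw [Multiset.sum_zero] at hsum
        omega
      have := Multiset.card_pos.2 hne
      rw [zero_add, numGE_one, hγ, Multiset.card_cons]
      omega
    · rw [add_zero]
  have h2 : ∀ l : n.Partition, (1 ∈ l.parts ∧ m + 2 ≤ numGE l.parts 1) ↔
      ∃ γ, l.parts = γ + {1} ∧ m + 1 ≤ numGE γ 1 := by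
    intro l
    rw [← mem_and_iff, if_pos le_rfl]
  simp only [h1, h2]
  have hs : ∀ x ∈ ({1} : Multiset ℕ), 0 < x := by simp
  rw [card_filter_add_parts n 1 {1} hs (by simp) fun γ => 1 ≤ numGE γ (m + 1),
    card_filter_add_parts n 1 {1} hs (by simp) fun γ => m + 1 ≤ numGE γ 1]
  congr 1
  convert card_filter_conj _ (fun l : (n - 1).Partition => m + 1 ≤ numGE l.parts 1)
    fun l => one_le_numGE_iff_conj l m

lemma part_one_le {n : ℕ} (l : n.Partition) : part l 1 ≤ n := by
  rcases Nat.eq_zero_or_pos (part l 1) with h | h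
  · omega
  · obtain ⟨x, hx, hx'⟩ := numGE_pos.1 ((le_part_one_iff l h).1 le_rfl)
    exact hx'.trans (l.le_of_mem_parts hx)

lemma le_crank_iff {n : ℕ} (l : n.Partition) (m : ℕ) :
    (m : ℤ) + 1 ≤ crank l ↔
      (l.parts.count 1 = 0 ∧ 1 ≤ numGE l.parts (m + 1)) ∨
        (l.parts.count 1 ≠ 0 ∧
          l.parts.count 1 + 1 + m ≤ numGE l.parts (l.parts.count 1 + 1)) := by
  unfold crank
  have h1 := le_part_one_iff l (i := m + 1) (by omega)
  have h2 : numGE l.parts (l.parts.count 1 + 1) =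
    (l.parts.filter fun x => l.parts.count 1 < x).card := Multiset.countP_eq_card_filter _ _
  split_ifs with h
  · rw [← h1]
    constructor
    · exact fun hc => Or.inl ⟨h, by omega⟩
    · rintro (⟨-, hc⟩ | ⟨hc, -⟩)
      · omega
      · exact absurd h hc
  · rw [h2]
    omega

open Classical in
lemma card_le_crank (n m : ℕ) (hn : 2 ≤ n) :
    (Finset.univ.filter fun l : n.Partition => (m : ℤ) + 1 ≤ crank l).card =
      (Finset.univ.filter fun l : n.Partition => Balanced m l.parts).card := by
  let K : ℕ → n.Partition → Prop := fun w l =>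
    if w = 0 then 1 ≤ numGE l.parts (m + 1) else w + 1 + m ≤ numGE l.parts (w + 1)
  let e : ℕ → ℕ := fun w =>
    (Finset.univ.filter fun l : n.Partition => w ≤ l.parts.count 1 ∧ K w l).card
  let g : ℕ → ℕ := fun w =>
    (Finset.univ.filter fun l : n.Partition => w + 1 ≤ l.parts.count 1 ∧ K w l).card
  let c : ℕ → ℕ := fun w =>
    (Finset.univ.filter fun l : n.Partition => l.parts.count 1 = w ∧ K w l).card
  let h : ℕ → ℕ := fun w =>
    (Finset.univ.filter fun l : n.Partition => w + 1 + m ≤ numGE l.parts (w + 1)).card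
  let b : ℕ → ℕ := fun w =>
    (Finset.univ.filter fun l : n.Partition => numGE l.parts (w + 1) = w + 1 + m).card
  let z : ℕ → ℕ := fun w => (Finset.univ.filter fun l : n.Partition =>
    w + 2 + m ≤ numGE l.parts (w + 1) ∧ numGE l.parts (w + 2) < w + 2 + m).card
  have hceg : ∀ w, c w + g w = e w := by
    intro w
    simp only [c, g, e]
    rw [← Finset.card_union_of_disjoint]
    · congr 1
      ext l
      simp only [Finset.mem_union, Finset.mem_filter, Finset.mem_univ, true_and, ← or_and_right]
      refine and_congr_left fun _ => ?_
      omega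
    · rw [Finset.disjoint_filter]
      rintro l - ⟨h1, -⟩ ⟨h2, -⟩
      omega
  have hg : ∀ w, g w = (Finset.univ.filter fun l : n.Partition =>
      w + 1 ∈ l.parts ∧ w + 2 + m ≤ numGE l.parts (w + 1)).card := by
    intro w
    rcases Nat.eq_zero_or_pos w with rfl | hw
    · simp only [g, K, if_true, zero_add]
      rw [card_filter_one_mem n m hn]
      simp only [add_comm]
    · simp only [g, K, if_neg hw.ne']
      rw [card_filter_le_count_one n (w + 1) (w + 1) _ (by omega) (by omega)]
      simp only [le_refl, if_true, show w + 1 + m + 1 = w + 2 + m by omega]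
  have he : ∀ w, e (w + 1) = (Finset.univ.filter fun l : n.Partition =>
      w + 1 ∈ l.parts ∧ w + 2 + m ≤ numGE l.parts (w + 2)).card := by
    intro w
    simp only [e, K, if_neg (Nat.succ_ne_zero w)]
    rw [card_filter_le_count_one n (w + 1) (w + 1 + 1) _ (by omega) (by omega)]
    simp only [if_neg (show ¬ w + 1 + 1 ≤ w + 1 by omega), add_zero]
  have hgez : ∀ w, g w = e (w + 1) + z w := by
    intro w
    rw [hg, he]
    simp only [z]
    rw [← Finset.card_union_of_disjoint]
    · congr 1
      ext l
      simp only [Finset.mem_union, Finset.mem_filter, Finset.mem_univ, true_and]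
      have h1 := numGE_succ_add_count l.parts (w + 1)
      have h2 : w + 1 ∈ l.parts ↔ 0 < l.parts.count (w + 1) := Multiset.count_pos.symm
      rw [h2]
      simp only [add_assoc, Nat.reduceAdd] at h1 ⊢
      omega
    · rw [Finset.disjoint_filter]
      rintro l - ⟨-, h1⟩ ⟨-, h2⟩
      omega
  have hhbz : ∀ w, h w = h (w + 1) + b w + z w := by
    intro w
    simp only [h, b, z]
    rw [add_assoc, ← Finset.card_union_of_disjoint, ← Finset.card_union_of_disjoint]
    · congr 1
      ext l
      simp only [Finset.mem_union, Finset.mem_filter, Finset.mem_univ, true_and]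
      have h1 := numGE_succ_add_count l.parts (w + 1)
      simp only [add_assoc, Nat.reduceAdd] at h1 ⊢
      omega
    all_goals
      rw [Finset.disjoint_left]
      intro l h1 h2
      simp only [Finset.mem_union, Finset.mem_filter, Finset.mem_univ, true_and] at h1 h2
      have h3 := numGE_succ_add_count l.parts (w + 1)
      simp only [add_assoc, Nat.reduceAdd] at h1 h2 h3
      omega
  have he0 : e 0 = h 0 := by
    simp only [e, h, K, if_true, zero_le, true_and, zero_add]
    rw [card_filter_conj _ (fun l : n.Partition => m + 1 ≤ numGE l.parts 1)
      fun l => one_le_numGE_iff_conj l m]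
    simp only [add_comm]
  have hen : e (n + 1) = 0 := by
    rw [he, Finset.card_eq_zero, Finset.filter_eq_empty_iff]
    rintro l - ⟨h1, -⟩
    have := l.le_of_mem_parts h1
    omega
  have hhn : h (n + 1) = 0 := by
    simp only [h]
    rw [Finset.card_eq_zero, Finset.filter_eq_empty_iff]
    intro l _ h1
    rw [numGE_eq_zero_of_lt l (by omega)] at h1
    omega
  have hsum : ∀ k, ∑ w ∈ Finset.range k, c w + e k = ∑ w ∈ Finset.range k, b w + h k := by
    intro k
    induction k with
    | zero => simpa using he0
    | succ k ih =>
      rw [Finset.sum_range_succ, Finset.sum_range_succ]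
      have := hceg k
      have := hgez k
      have := hhbz k
      omega
  have hC : (Finset.univ.filter fun l : n.Partition => (m : ℤ) + 1 ≤ crank l).card =
      ∑ w ∈ Finset.range (n + 1), c w := by
    rw [Finset.card_eq_sum_card_fiberwise (f := fun l : n.Partition => l.parts.count 1)
      (t := Finset.range (n + 1))]
    · refine Finset.sum_congr rfl fun w _ => ?_
      simp only [c, Finset.filter_filter]
      congr 1
      ext l
      simp only [Finset.mem_filter, Finset.mem_univ, true_and, le_crank_iff, K]
      constructor
      · rintro ⟨h1, rfl⟩
        refine ⟨rfl, ?_⟩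
        split_ifs with h0
        · exact (h1.resolve_right fun h' => h'.1 h0).2
        · exact (h1.resolve_left fun h' => h0 h'.1).2
      · rintro ⟨rfl, h1⟩
        refine ⟨?_, rfl⟩
        split_ifs at h1 with h0
        · exact Or.inl ⟨h0, h1⟩
        · exact Or.inr ⟨h0, h1⟩
    · intro l _
      have h1 : l.parts.count 1 ≤ l.parts.card := Multiset.count_le_card _ _
      have h2 : l.parts.card ≤ n := by
        rw [← part_one_conj]
        exact part_one_le _
      simp only [Finset.coe_range, Set.mem_Iio]
      omega
  have hB : (Finset.univ.filter fun l : n.Partition => Balanced m l.parts).card =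
      ∑ w ∈ Finset.range (n + 1), b w := by
    simp only [b]
    rw [← Finset.card_biUnion]
    · congr 1
      ext l
      simp only [Finset.mem_filter, Finset.mem_univ, true_and, Finset.mem_biUnion,
        Finset.mem_range]
      constructor
      · rintro ⟨j, hj1, hj⟩
        refine ⟨j - 1, ?_, ?_⟩
        · by_contra hlt
          rw [numGE_eq_zero_of_lt l (by omega)] at hj
          omega
        · rw [Nat.sub_add_cancel hj1]
          omega
      · rintro ⟨w, -, hw⟩
        exact ⟨w + 1, by omega, by omega⟩
    · intro w _ w' _ hne
      refine Finset.disjoint_filter.2 fun l _ h1 h2 => ?_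
      rcases Nat.lt_or_gt_of_ne hne with hlt | hlt
      · have := numGE_antitone l.parts (show w + 1 ≤ w' + 1 by omega)
        omega
      · have := numGE_antitone l.parts (show w' + 1 ≤ w + 1 by omega)
        omega
  have := hsum (n + 1)
  omega

lemma rank_le {n : ℕ} (l : n.Partition) : rank l ≤ n := by
  have := part_one_le l
  unfold rank
  omega

lemma crank_le {n : ℕ} (l : n.Partition) : crank l ≤ n := by
  have h1 := part_one_le l
  have h2 : (l.parts.filter fun x => l.parts.count 1 < x).card ≤ n := by
    refine (Multiset.card_le_card (Multiset.filter_le _ _)).trans ?_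
    rw [← part_one_conj]
    exact part_one_le _
  unfold crank
  split_ifs <;> omega

lemma sum_range_ite_succ_le (n : ℕ) (x : ℤ) :
    ∑ k ∈ Finset.range n, (if (k : ℤ) + 1 ≤ x then (1 : ℤ) else 0) = min (max x 0) n := by
  induction n with
  | zero => simp
  | succ n ih =>
    rw [Finset.sum_range_succ, ih]
    split_ifs <;> omega

lemma sum_mul_card_eq {n : ℕ} (f : n.Partition → ℤ) (hf : ∀ l, f l ≤ n) :
    ∑ m ∈ Finset.Icc (0 : ℤ) n, m * (Nat.card {l : n.Partition // f l = m} : ℤ) =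
      ∑ k ∈ Finset.range n,
        ((Finset.univ.filter fun l : n.Partition => (k : ℤ) + 1 ≤ f l).card : ℤ) := by
  simp only [Nat.card_eq_fintype_card, Fintype.card_subtype, Finset.card_filter, Nat.cast_sum,
    Nat.cast_ite, Nat.cast_one, Nat.cast_zero, Finset.mul_sum, mul_ite, mul_one, mul_zero]
  rw [Finset.sum_comm, Finset.sum_comm (s := Finset.range n)]
  refine Finset.sum_congr rfl fun l _ => ?_
  rw [sum_range_ite_succ_le, Finset.sum_ite_eq]
  have := hf l
  simp only [Finset.mem_Icc]
  split_ifs <;> omega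

lemma two_mul_ospt_lt (n : ℕ) (hn : 3 ≤ n) : 2 * ospt n < p n := by
  classical
  have hM : ∀ m, M m n = (Nat.card {l : n.Partition // crank l = m} : ℤ) := fun m =>
    if_neg (by omega)
  have hp : p n = Fintype.card n.Partition := Nat.card_eq_fintype_card
  unfold ospt
  simp only [hM, N]
  rw [sum_mul_card_eq _ crank_le, sum_mul_card_eq _ rank_le, hp]
  let C : ℕ → ℤ := fun k =>
    ((Finset.univ.filter fun l : n.Partition => (k : ℤ) + 1 ≤ crank l).card : ℤ)
  let R : ℕ → ℤ := fun k =>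
    ((Finset.univ.filter fun l : n.Partition => (k : ℤ) + 1 ≤ rank l).card : ℤ)
  have hCR : ∀ k, C (k + 1) ≤ R k := by
    intro k
    have h1 := card_le_crank n (k + 1) (by omega)
    have h2 := card_balanced_le (k + 1) n
    simp only [C, R]
    push_cast at h1 h2 ⊢
    rw [h1]
    exact_mod_cast h2
  have hC0 : 2 * C 0 < Fintype.card n.Partition := by
    have h1 := card_le_crank n 0 (by omega)
    have h2 := two_mul_card_balanced_lt hn
    simp only [C]
    rw [h1]
    exact_mod_cast h2
  have h1 : ∑ k ∈ Finset.range n, C k ≤ ∑ k ∈ Finset.range n, C (k + 1) + C 0 := by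
    rw [← Finset.sum_range_succ', Finset.sum_range_succ]
    exact le_add_of_nonneg_right (Int.natCast_nonneg _)
  have h2 : ∑ k ∈ Finset.range n, C (k + 1) ≤ ∑ k ∈ Finset.range n, R k :=
    Finset.sum_le_sum fun k _ => hCR k
  change 2 * (∑ k ∈ Finset.range n, C k - ∑ k ∈ Finset.range n, R k) < _
  omega

end RankCrank

open RankCrank in
/-- For every `n ≥ 3`, `ospt n < p(n)/2`. -/
theorem ospt_lt_half (n : ℕ) (hn : 3 ≤ n) :
    (ospt n : ℚ) < (p n : ℚ) / 2 := by
  have h : (2 * ospt n : ℚ) < p n := by exact_mod_cast two_mul_ospt_lt n hn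
  linarith
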